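/- Determinant of the symmetric Kronecker square: for every A ∈ ℝ^{n×n}, det(A ⊗ₛ A) = det(A)^{n+1}. -/

import Mathlib

open Matrix

noncomputable section

/-- `n̄ = n(n+1)/2`, the dimension of the space of symmetric `n × n` matrices. -/
def triDim (n : ℕ) : ℕ := n * (n + 1) / 2

/-- The (0-based) row/column pair `(r(j), c(j))` of the `j`-th position in the
lexicographic (left-to-right, top-to-bottom) enumeration of the on-or-above-diagonal
positions of an `n × n` matrix. -/
def rcPair : ℕ → ℕ → ℕ × ℕ
  | 0, _ => (0, 0)
  | (m + 1), j =>
      if j < m + 1 then (0, j)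
      else ((rcPair m (j - (m + 1))).1 + 1, (rcPair m (j - (m + 1))).2 + 1)

/-- The orthonormal basis `E_j` of the space of symmetric `n × n` matrices:
`E_j = e_{r(j)} e_{c(j)}ᵀ` if `r(j) = c(j)`, and
`E_j = (√2/2) (e_{r(j)} e_{c(j)}ᵀ + e_{c(j)} e_{r(j)}ᵀ)` if `r(j) < c(j)`. -/
def symBasis (n : ℕ) (j : Fin (triDim n)) : Matrix (Fin n) (Fin n) ℝ :=
  if (rcPair n j).1 = (rcPair n j).2 then
    Matrix.of fun a b : Fin n =>
      if (a : ℕ) = (rcPair n j).1 ∧ (b : ℕ) = (rcPair n j).2 then (1 : ℝ) else 0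
  else
    Matrix.of fun a b : Fin n =>
      if ((a : ℕ) = (rcPair n j).1 ∧ (b : ℕ) = (rcPair n j).2) ∨
          ((a : ℕ) = (rcPair n j).2 ∧ (b : ℕ) = (rcPair n j).1) then
        Real.sqrt 2 / 2
      else 0

/-- Column-stacking vectorization `vec : ℝ^{m×n} → ℝ^{nm}`: `vec(A)_{j·m + i} = A_{i,j}`
(0-based), realized through `finProdFinEquiv (j, i) = j * m + i`. -/
def mvec {m n : ℕ} (A : Matrix (Fin m) (Fin n) ℝ) : Fin (n * m) → ℝ :=
  fun k => A (finProdFinEquiv.symm k).2 (finProdFinEquiv.symm k).1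

/-- The matrix `W_n ∈ ℝ^{n̄ × n²}` whose `j`-th row is `vec(E_j)ᵀ`. -/
def Wmat (n : ℕ) : Matrix (Fin (triDim n)) (Fin (n * n)) ℝ :=
  Matrix.of fun j k => mvec (symBasis n j) k

/-- The Kronecker product on `Fin`-indexed matrices, with the standard flattening
`(A ⊗ B)_{(i·p + k, j·q + l)} = A_{i,j} B_{k,l}`. -/
def kron {m n p q : ℕ} (A : Matrix (Fin m) (Fin n) ℝ) (B : Matrix (Fin p) (Fin q) ℝ) :
    Matrix (Fin (m * p)) (Fin (n * q)) ℝ :=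
  Matrix.reindex finProdFinEquiv finProdFinEquiv (Matrix.kroneckerMap (· * ·) A B)

/-- The symmetric Kronecker product `A ⊗ₛ B = W_m (A ⊗ B) W_nᵀ ∈ ℝ^{m̄ × n̄}`
of rectangular matrices `A, B ∈ ℝ^{m×n}`. -/
def skron {m n : ℕ} (A B : Matrix (Fin m) (Fin n) ℝ) :
    Matrix (Fin (triDim m)) (Fin (triDim n)) ℝ :=
  Wmat m * kron A B * (Wmat n)ᵀ

/-- The Frobenius inner product `⟨A, B⟩_F = trace(Aᵀ B)`. -/
def frobInner {m n : ℕ} (A B : Matrix (Fin m) (Fin n) ℝ) : ℝ :=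
  (Aᵀ * B).trace

/-- Symmetric vectorization `svec(P)_j = ⟨P, E_j⟩_F`. -/
def svec {n : ℕ} (P : Matrix (Fin n) (Fin n) ℝ) : Fin (triDim n) → ℝ :=
  fun j => frobInner P (symBasis n j)

/-- The symmetric part `π(A) = (A + Aᵀ)/2`. -/
def symPart {n : ℕ} (A : Matrix (Fin n) (Fin n) ℝ) : Matrix (Fin n) (Fin n) ℝ :=
  (1 / 2 : ℝ) • (A + Aᵀ)

/-- The symmetric Kronecker sum `A ⊕ₛ B = A ⊗ₛ I + I ⊗ₛ B`. -/
def skronSum {n : ℕ} (A B : Matrix (Fin n) (Fin n) ℝ) :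
    Matrix (Fin (triDim n)) (Fin (triDim n)) ℝ :=
  skron A 1 + skron 1 B

/-- A vector `x ∈ ℝⁿ` regarded as an `n × 1` matrix. -/
def colVec {n : ℕ} (x : Fin n → ℝ) : Matrix (Fin n) (Fin 1) ℝ :=
  Matrix.of fun i _ => x i

theorem triDim_succ (n : ℕ) : triDim (n + 1) = triDim n + (n + 1) := by
  unfold triDim
  rw [show (n + 1) * (n + 1 + 1) = n * (n + 1) + (n + 1) * 2 by ring,
    Nat.add_mul_div_right _ _ two_pos]

theorem rcPair_succ_of_lt {n j : ℕ} (h : j < n + 1) : rcPair (n + 1) j = (0, j) := by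
  simp [rcPair, h]

theorem rcPair_succ_add (n j : ℕ) :
    rcPair (n + 1) (n + 1 + j) = ((rcPair n j).1 + 1, (rcPair n j).2 + 1) := by
  simp [rcPair, show ¬ n + 1 + j < n + 1 by omega]

theorem rcPair_bounds (n j : ℕ) (h : j < triDim n) :
    (rcPair n j).1 ≤ (rcPair n j).2 ∧ (rcPair n j).2 < n := by
  induction n generalizing j with
  | zero => simp [triDim] at h
  | succ n ih =>
    rw [triDim_succ] at h
    by_cases hj : j < n + 1
    · simp [rcPair_succ_of_lt hj, hj]
    · obtain ⟨k, rfl⟩ := Nat.exists_eq_add_of_le (not_lt.mp hj)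
      have := ih k (by omega)
      rw [rcPair_succ_add]
      simpa using this

theorem rcPair_injOn (n j k : ℕ) (hj : j < triDim n) (hk : k < triDim n)
    (h : rcPair n j = rcPair n k) : j = k := by
  induction n generalizing j k with
  | zero => simp [triDim] at hj
  | succ n ih =>
    rw [triDim_succ] at hj hk
    by_cases hj' : j < n + 1 <;> by_cases hk' : k < n + 1
    · simpa [rcPair_succ_of_lt hj', rcPair_succ_of_lt hk'] using h
    · obtain ⟨k, rfl⟩ := Nat.exists_eq_add_of_le (not_lt.mp hk')
      simp [rcPair_succ_of_lt hj', rcPair_succ_add] at h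
    · obtain ⟨j, rfl⟩ := Nat.exists_eq_add_of_le (not_lt.mp hj')
      simp [rcPair_succ_of_lt hk', rcPair_succ_add] at h
    · obtain ⟨j, rfl⟩ := Nat.exists_eq_add_of_le (not_lt.mp hj')
      obtain ⟨k, rfl⟩ := Nat.exists_eq_add_of_le (not_lt.mp hk')
      rw [rcPair_succ_add, rcPair_succ_add] at h
      simp only [Prod.mk.injEq, add_left_inj] at h
      rw [ih j k (by omega) (by omega) (Prod.ext h.1 h.2)]

theorem exists_rcPair_eq (n a b : ℕ) (hab : a ≤ b) (hb : b < n) :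
    ∃ j < triDim n, rcPair n j = (a, b) := by
  induction n generalizing a b with
  | zero => omega
  | succ n ih =>
    rw [triDim_succ]
    cases a with
    | zero => exact ⟨b, by omega, rcPair_succ_of_lt hb⟩
    | succ a =>
      obtain ⟨j, hj, h⟩ := ih a (b - 1) (by omega) (by omega)
      refine ⟨n + 1 + j, by omega, ?_⟩
      rw [rcPair_succ_add, h]
      simp only [Prod.mk.injEq, true_and]
      omega

theorem prod_rcPair (n : ℕ) (d : ℕ → ℝ) :
    ∏ j ∈ Finset.range (triDim n), d (rcPair n j).1 * d (rcPair n j).2 =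
      (∏ i ∈ Finset.range n, d i) ^ (n + 1) := by
  induction n generalizing d with
  | zero => simp [triDim]
  | succ n ih =>
    rw [triDim_succ, add_comm, Finset.prod_range_add]
    simp only [rcPair_succ_add]
    rw [ih fun i => d (i + 1)]
    have h : ∏ j ∈ Finset.range (n + 1), d (rcPair (n + 1) j).1 * d (rcPair (n + 1) j).2 =
        ∏ j ∈ Finset.range (n + 1), d 0 * d j :=
      Finset.prod_congr rfl fun j hj => by rw [rcPair_succ_of_lt (Finset.mem_range.mp hj)]
    rw [h, Finset.prod_mul_distrib, Finset.prod_const, Finset.card_range,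
      Finset.prod_range_succ']
    ring

theorem symBasis_apply_symm {n : ℕ} (j : Fin (triDim n)) (a b : Fin n) :
    symBasis n j a b = symBasis n j b a := by
  unfold symBasis
  split_ifs with h
  · simp only [of_apply, h]
    congr 1
    exact propext and_comm
  · simp only [of_apply]
    congr 1
    exact propext (or_comm.trans (or_congr and_comm and_comm))

theorem symBasis_apply_of_ne {n : ℕ} {j : Fin (triDim n)} {a b : Fin n}
    (h₁ : ¬ ((a : ℕ) = (rcPair n j).1 ∧ (b : ℕ) = (rcPair n j).2))
    (h₂ : ¬ ((a : ℕ) = (rcPair n j).2 ∧ (b : ℕ) = (rcPair n j).1)) :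
    symBasis n j a b = 0 := by
  unfold symBasis
  split_ifs with h <;> simp only [of_apply] <;> simp [h₁, h₂]

theorem exists_rcPair_support {n : ℕ} (a b : Fin n) (hab : a ≤ b) :
    ∃ j : Fin (triDim n), rcPair n j = ((a : ℕ), (b : ℕ)) ∧
      ∀ k, k ≠ j → symBasis n k a b = 0 := by
  obtain ⟨j, hj, h⟩ := exists_rcPair_eq n a b hab b.2
  refine ⟨⟨j, hj⟩, h, fun k hk => ?_⟩
  have hne : rcPair n k ≠ ((a : ℕ), (b : ℕ)) := fun h' =>
    hk (Fin.ext (rcPair_injOn n k j k.2 hj (h'.trans h.symm)))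
  have hle := (rcPair_bounds n k k.2).1
  have hab' : (a : ℕ) ≤ b := hab
  rw [Ne, Prod.ext_iff] at hne
  dsimp only at hne
  exact symBasis_apply_of_ne (by omega) (by omega)

theorem sum_symBasis_mul_of_le {n : ℕ} (a b c d : Fin n) (hab : a ≤ b) :
    ∑ j, symBasis n j a b * symBasis n j c d =
      (1 / 2 : ℝ) * ((if (a, b) = (c, d) then 1 else 0) + if (b, a) = (c, d) then 1 else 0) := by
  obtain ⟨j, hj, h⟩ := exists_rcPair_support a b hab
  rw [Finset.sum_eq_single j (fun k _ hk => by rw [h k hk, zero_mul]) (by simp)]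
  have h2 : √2 / 2 * (√2 / 2) = (1 / 2 : ℝ) := by
    have := Real.mul_self_sqrt (zero_le_two (α := ℝ))
    linarith
  simp only [symBasis, hj, Fin.val_inj, Prod.mk.injEq]
  by_cases hab : a = b
  · simp only [hab, if_true, of_apply]
    grind
  · simp only [hab, if_false, of_apply]
    grind

theorem sum_symBasis_mul {n : ℕ} (a b c d : Fin n) :
    ∑ j, symBasis n j a b * symBasis n j c d =
      (1 / 2 : ℝ) * ((if (a, b) = (c, d) then 1 else 0) + if (b, a) = (c, d) then 1 else 0) := by
  rcases le_total a b with h | h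
  · exact sum_symBasis_mul_of_le a b c d h
  · simp_rw [fun j => symBasis_apply_symm j a b]
    rw [sum_symBasis_mul_of_le b a c d h, add_comm]

/-- The transposition of the two factors of `Fin n × Fin n`, on flattened indices. -/
def swapFin (n : ℕ) : Equiv.Perm (Fin (n * n)) :=
  (finProdFinEquiv.symm.trans (Equiv.prodComm _ _)).trans finProdFinEquiv

theorem swapFin_swapFin {n : ℕ} (k : Fin (n * n)) : swapFin n (swapFin n k) = k := by
  simp only [swapFin, Equiv.trans_apply, Equiv.symm_apply_apply, Equiv.prodComm_apply,
    Prod.swap_swap, Equiv.apply_symm_apply]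

theorem Wmat_transpose_mul_Wmat (n : ℕ) :
    (Wmat n)ᵀ * Wmat n = (1 / 2 : ℝ) • (1 + (1 : Matrix _ _ ℝ).submatrix (swapFin n) id) := by
  ext k l
  obtain ⟨⟨a, b⟩, rfl⟩ := finProdFinEquiv.surjective k
  obtain ⟨⟨c, d⟩, rfl⟩ := finProdFinEquiv.surjective l
  simp only [mul_apply, transpose_apply, Wmat, of_apply, mvec, Equiv.symm_apply_apply,
    sum_symBasis_mul, Matrix.smul_apply, Matrix.add_apply, submatrix_apply, one_apply, swapFin, id,
    Equiv.trans_apply, Equiv.prodComm_apply, Prod.swap_prod_mk, EmbeddingLike.apply_eq_iff_eq,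
    smul_eq_mul, Prod.mk.injEq, and_comm]

theorem kron_mul_kron {n : ℕ} (A B C D : Matrix (Fin n) (Fin n) ℝ) :
    kron A B * kron C D = kron (A * C) (B * D) := by
  simp only [kron, reindex_apply, submatrix_mul_equiv]
  congr 1
  exact (mul_kronecker_mul A C B D).symm

theorem Wmat_transpose_mul_Wmat_mul_kron {n : ℕ} (A : Matrix (Fin n) (Fin n) ℝ) :
    (Wmat n)ᵀ * Wmat n * kron A A = kron A A * ((Wmat n)ᵀ * Wmat n) := by
  rw [Wmat_transpose_mul_Wmat, smul_mul_assoc, mul_smul_comm, add_mul, mul_add, one_mul, mul_one]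
  congr 2
  ext k l
  have h (m : Fin (n * n)) : swapFin n m = l ↔ m = swapFin n l :=
    ⟨fun h => by rw [← h, swapFin_swapFin], fun h => by rw [h, swapFin_swapFin]⟩
  simp [mul_apply, one_apply, h]
  simp [kron, swapFin, mul_comm]

theorem sum_symBasis_apply_mul {n : ℕ} (j k : Fin (triDim n)) :
    ∑ a, ∑ b, symBasis n j a b * symBasis n k a b = if j = k then 1 else 0 := by
  obtain ⟨hle, hlt⟩ := rcPair_bounds n j j.2
  have hle' := (rcPair_bounds n k k.2).1
  by_cases hjk : j = k
  · subst hjk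
    obtain ⟨r, hr⟩ : ∃ r : Fin n, (r : ℕ) = (rcPair n j).1 := ⟨⟨_, hle.trans_lt hlt⟩, rfl⟩
    obtain ⟨c, hc⟩ : ∃ c : Fin n, (c : ℕ) = (rcPair n j).2 := ⟨⟨_, hlt⟩, rfl⟩
    rw [if_pos rfl]
    simp only [symBasis, ← hr, ← hc, Fin.val_inj]
    by_cases hrc : r = c
    · simp [hrc, ite_and]
    · have h (a b : Fin n) : (if (a = r ∧ b = c) ∨ (a = c ∧ b = r) then √2 / 2 else 0) *
          (if (a = r ∧ b = c) ∨ (a = c ∧ b = r) then √2 / 2 else 0) =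
          (if a = r then if b = c then (1 / 2 : ℝ) else 0 else 0) +
            if a = c then if b = r then (1 / 2 : ℝ) else 0 else 0 := by
        have h2 := Real.mul_self_sqrt (zero_le_two (α := ℝ))
        grind
      simp only [if_neg hrc, of_apply, h, Finset.sum_add_distrib]
      simp
      norm_num
  · rw [if_neg hjk]
    have hne : rcPair n j ≠ rcPair n k := fun h => hjk (Fin.ext (rcPair_injOn n j k j.2 k.2 h))
    rw [Ne, Prod.ext_iff] at hne
    refine Finset.sum_eq_zero fun a _ => Finset.sum_eq_zero fun b _ => ?_
    by_cases h : ((a : ℕ) = (rcPair n j).1 ∧ (b : ℕ) = (rcPair n j).2) ∨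
        ((a : ℕ) = (rcPair n j).2 ∧ (b : ℕ) = (rcPair n j).1)
    · rw [symBasis_apply_of_ne (j := k) (by omega) (by omega), mul_zero]
    · rw [not_or] at h
      rw [symBasis_apply_of_ne h.1 h.2, zero_mul]

theorem Wmat_mul_transpose (n : ℕ) : Wmat n * (Wmat n)ᵀ = 1 := by
  ext j k
  rw [one_apply, ← sum_symBasis_apply_mul, mul_apply, ← finProdFinEquiv.sum_comp,
    Fintype.sum_prod_type, Finset.sum_comm]
  simp only [Wmat, mvec, of_apply, transpose_apply, Equiv.symm_apply_apply]

theorem skron_self_mul {n : ℕ} (A B : Matrix (Fin n) (Fin n) ℝ) :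
    skron (A * B) (A * B) = skron A A * skron B B := by
  have h : (Wmat n)ᵀ * Wmat n * (Wmat n)ᵀ = (Wmat n)ᵀ := by
    rw [Matrix.mul_assoc, Wmat_mul_transpose, Matrix.mul_one]
  calc skron (A * B) (A * B) = Wmat n * kron A A * (kron B B * (Wmat n)ᵀ) := by
        simp only [skron, ← kron_mul_kron, Matrix.mul_assoc]
    _ = Wmat n * kron A A * (kron B B * ((Wmat n)ᵀ * Wmat n) * (Wmat n)ᵀ) := by
        rw [Matrix.mul_assoc (kron B B), h]
    _ = skron A A * skron B B := by
        rw [← Wmat_transpose_mul_Wmat_mul_kron]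
        simp only [skron, Matrix.mul_assoc]

theorem skron_diagonal {n : ℕ} (d : ℕ → ℝ) :
    skron (diagonal fun i : Fin n => d i) (diagonal fun i : Fin n => d i) =
      diagonal fun j : Fin (triDim n) => d (rcPair n j).1 * d (rcPair n j).2 := by
  have h : kron (diagonal fun i : Fin n => d i) (diagonal fun i : Fin n => d i) * (Wmat n)ᵀ =
      (Wmat n)ᵀ * diagonal fun j : Fin (triDim n) => d (rcPair n j).1 * d (rcPair n j).2 := by
    have hk : kron (diagonal fun i : Fin n => d i) (diagonal fun i : Fin n => d i) =
        diagonal fun k => d (finProdFinEquiv.symm k).1 * d (finProdFinEquiv.symm k).2 := by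
      unfold kron
      rw [kroneckerMap_diagonal_diagonal _ (by simp) (by simp), reindex_apply,
        submatrix_diagonal_equiv]
      rfl
    rw [hk]
    ext k j
    rw [diagonal_mul, mul_diagonal]
    simp only [transpose_apply, Wmat, of_apply, mvec]
    generalize (finProdFinEquiv.symm k).1 = b
    generalize (finProdFinEquiv.symm k).2 = a
    by_cases h₁ : (a : ℕ) = (rcPair n j).1 ∧ (b : ℕ) = (rcPair n j).2
    · rw [h₁.1, h₁.2]; ring
    · by_cases h₂ : (a : ℕ) = (rcPair n j).2 ∧ (b : ℕ) = (rcPair n j).1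
      · rw [h₂.1, h₂.2]; ring
      · simp [symBasis_apply_of_ne h₁ h₂]
  rw [skron, Matrix.mul_assoc, h, ← Matrix.mul_assoc, Wmat_mul_transpose, Matrix.one_mul]

theorem det_skron_diagonal {n : ℕ} (D : Fin n → ℝ) :
    (skron (diagonal D) (diagonal D)).det = (diagonal D).det ^ (n + 1) := by
  obtain ⟨d, rfl⟩ : ∃ d : ℕ → ℝ, D = fun i : Fin n => d i :=
    ⟨fun i => if h : i < n then D ⟨i, h⟩ else 0, by simp⟩
  rw [skron_diagonal, det_diagonal, det_diagonal,
    Fin.prod_univ_eq_prod_range (fun j => d (rcPair n j).1 * d (rcPair n j).2), prod_rcPair,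
    Fin.prod_univ_eq_prod_range d]

/-- A multiplicative real-valued function of matrices is `1` on transvections: these are
commutators of a transvection with a diagonal matrix. -/
theorem map_transvection_eq_one {n : ℕ} (f : Matrix (Fin n) (Fin n) ℝ →* ℝ) {i j : Fin n}
    (hij : i ≠ j) (c : ℝ) : f (transvection i j c) = 1 := by
  have hinv : f (transvection i j c) * f (transvection i j (-c)) = 1 := by
    rw [← map_mul, transvection_mul_transvection_same _ _ hij, add_neg_cancel,
      transvection_zero, map_one]
  have hd : (diagonal (Function.update 1 i (2 : ℝ)) : Matrix (Fin n) (Fin n) ℝ) *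
      diagonal (Function.update 1 i (2⁻¹ : ℝ)) = 1 := by
    rw [diagonal_mul_diagonal, ← diagonal_one]
    congr 1
    ext k
    by_cases hk : k = i
    · subst hk; simp
    · simp [hk]
  have hconj : diagonal (Function.update 1 i (2 : ℝ)) * transvection i j c =
      transvection i j (c + c) * diagonal (Function.update 1 i (2 : ℝ)) := by
    ext k l
    rw [diagonal_mul, mul_diagonal]
    by_cases hk : k = i <;> by_cases hl : l = j <;>
      simp [transvection, single_apply, one_apply, Function.update_apply] <;> grind
  have hf := congrArg f hconj
  have hfd := congrArg f hd
  rw [← transvection_mul_transvection_same _ _ hij] at hf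
  simp only [map_mul, map_one] at hf hfd
  have h0 : f (transvection i j c) ≠ 0 := left_ne_zero_of_mul_eq_one hinv
  have h1 := left_ne_zero_of_mul_eq_one hfd
  have : f (transvection i j c) * f (diagonal (Function.update 1 i (2 : ℝ))) *
      (f (transvection i j c) - 1) = 0 := by linear_combination -hf
  have := (mul_eq_zero.mp this).resolve_left (mul_ne_zero h0 h1)
  linarith

/-- `det(A ⊗ₛ A) = det(A)^{n+1}`. -/
theorem skron_sq_det (n : ℕ) (A : Matrix (Fin n) (Fin n) ℝ) :
    (skron A A).det = A.det ^ (n + 1) := by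
  have hone : (skron (1 : Matrix (Fin n) (Fin n) ℝ) 1).det = 1 := by
    rw [← diagonal_one, det_skron_diagonal, diagonal_one, det_one, one_pow]
  let f : Matrix (Fin n) (Fin n) ℝ →* ℝ :=
    { toFun := fun A => (skron A A).det
      map_one' := hone
      map_mul' := fun A B => by rw [skron_self_mul, det_mul] }
  refine diagonal_transvection_induction (fun A => (skron A A).det = A.det ^ (n + 1)) A
    (fun D _ => det_skron_diagonal D) (fun t => ?_) (fun A B hA hB => ?_)
  · rw [TransvectionStruct.det, one_pow]
    exact map_transvection_eq_one f t.hij t.c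
  · rw [skron_self_mul, det_mul, hA, hB, det_mul, mul_pow]
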